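/- Let ν be a σ-finite measure on a measurable space 𝒳 and ρ a σ-finite measure on a measurable space 𝒴. Let p : 𝒳×𝒴 → ℝ≥0 be a probability density with respect to ν⊗ρ, q : 𝒳 → ℝ≥0 a probability density with respect to ν, and w : 𝒴 → ℝ≥0 measurable with ∫ p(y)·w(y) dρ(y) = 1, where p(y) := ∫ p(x,y) dν(x). Define p^w(x) := ∫ p(x,y)·w(y) dρ(y), a probability density with respect to ν. For measurable d : 𝒳 → (0,1), define I(d) := ∫∫∫ [−w(y)·log d(x) − log(1 − d(x'))] p(x,y)·q(x') dν(x) dν(x') dρ(y). Then the minimum value of I over all such d equals log 4 − 2·D_JS(P^w ‖ Q), where P^w and Q are the probability measures with densities p^w and q with respect to ν, and the minimum is attained at d*(x) = p^w(x)/(p^w(x) + q(x)). -/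

import Mathlib

open MeasureTheory Real
open scoped ENNReal

/-- Kullback–Leibler divergence (real-valued, via the Radon–Nikodym derivative). -/
noncomputable def klDiv {Ω : Type*} [MeasurableSpace Ω] (μ ν : Measure Ω) : ℝ :=
  ∫ x, Real.log ((μ.rnDeriv ν) x).toReal ∂μ

/-- Jensen–Shannon divergence: `(1/2)·KL(μ‖M) + (1/2)·KL(ν‖M)` with `M = (μ+ν)/2`. -/
noncomputable def jsDiv {Ω : Type*} [MeasurableSpace Ω] (μ ν : Measure Ω) : ℝ :=
  (1 / 2) * klDiv μ ((2 : ℝ≥0∞)⁻¹ • (μ + ν)) + (1 / 2) * klDiv ν ((2 : ℝ≥0∞)⁻¹ • (μ + ν))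

/-- `w`-reweighted marginal density `p^w(x) = ∫ p(x,y)·w(y) dρ(y)`. -/
noncomputable def pwDensity {𝒳 𝒴 : Type*} [MeasurableSpace 𝒳] [MeasurableSpace 𝒴]
    (ρ : Measure 𝒴) (p : 𝒳 × 𝒴 → ℝ) (w : 𝒴 → ℝ) (x : 𝒳) : ℝ :=
  ∫ y, p (x, y) * w y ∂ρ

/-- The (weighted) adversarial objective
`I(d) = ∫∫∫ [−w(y)·log d(x) − log(1 − d(x'))] p(x,y)·q(x') dν(x) dν(x') dρ(y)`,
computed as a lower integral of its (nonnegative) integrand. -/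
noncomputable def ganObjective {𝒳 𝒴 : Type*} [MeasurableSpace 𝒳] [MeasurableSpace 𝒴]
    (ν : Measure 𝒳) (ρ : Measure 𝒴) (p : 𝒳 × 𝒴 → ℝ) (q : 𝒳 → ℝ) (w : 𝒴 → ℝ)
    (d : 𝒳 → ℝ) : ℝ≥0∞ :=
  ∫⁻ z : (𝒳 × 𝒳) × 𝒴,
    ENNReal.ofReal ((-(w z.2 * Real.log (d z.1.1)) - Real.log (1 - d z.1.2)) *
      (p (z.1.1, z.2) * q z.1.2)) ∂((ν.prod ν).prod ρ)

section Auxiliary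

variable {𝒳 𝒴 : Type*} [MeasurableSpace 𝒳] [MeasurableSpace 𝒴]

lemma abs_mul_log_div_half_add_le {a b : ℝ} (ha : 0 ≤ a) (hb : 0 ≤ b) :
    |a * log (a / ((a + b) / 2))| ≤ a + b := by
  rcases ha.eq_or_lt with rfl | ha
  · simpa using hb
  have hm : 0 < (a + b) / 2 := by positivity
  have h1 : a / ((a + b) / 2) ≤ 2 := by rw [div_le_iff₀ hm]; linarith
  have h2 := log_le_sub_one_of_pos (div_pos ha hm)
  have h3 := one_sub_inv_le_log_of_pos (div_pos ha hm)
  have h4 : a * (1 - (a / ((a + b) / 2))⁻¹) = a - (a + b) / 2 := by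
    field_simp
  have h5 := mul_le_mul_of_nonneg_left h3 ha.le
  have h6 : a * log (a / ((a + b) / 2)) ≤ a * 1 :=
    mul_le_mul_of_nonneg_left (by linarith) ha.le
  rw [abs_le]
  constructor <;> linarith

/-- Gibbs' inequality on two points, with unnormalized weights. -/
lemma crossEntropy_div_add_le {a b t : ℝ} (ha : 0 ≤ a) (hb : 0 ≤ b) (ht : t ∈ Set.Ioo (0 : ℝ) 1) :
    -log (a / (a + b)) * a + -log (1 - a / (a + b)) * b ≤ -log t * a + -log (1 - t) * b := by
  have ht0 : 0 ≤ -log t := neg_nonneg.2 (log_nonpos ht.1.le ht.2.le)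
  have ht1 : 0 ≤ -log (1 - t) :=
    neg_nonneg.2 (log_nonpos (by linarith [ht.2]) (by linarith [ht.1]))
  rcases ha.eq_or_lt with rfl | ha
  · simpa using mul_nonneg ht1 hb
  rcases hb.eq_or_lt with rfl | hb
  · simpa [ha.ne'] using mul_nonneg ht0 ha.le
  have hs : 0 < a + b := by positivity
  have e : 1 - a / (a + b) = b / (a + b) := by field_simp; ring
  rw [e]
  have u : 0 < 1 - t := by linarith [ht.2]
  have h1 := log_le_sub_one_of_pos (div_pos ht.1 (div_pos ha hs))
  have h2 := log_le_sub_one_of_pos (div_pos u (div_pos hb hs))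
  rw [log_div ht.1.ne' (div_pos ha hs).ne'] at h1
  rw [log_div u.ne' (div_pos hb hs).ne'] at h2
  have h3 := mul_le_mul_of_nonneg_left h1 ha.le
  have h4 := mul_le_mul_of_nonneg_left h2 hb.le
  have h5 : a * (t / (a / (a + b)) - 1) + b * ((1 - t) / (b / (a + b)) - 1) = 0 := by
    field_simp
    ring
  linarith

lemma crossEntropy_div_add_eq {a b : ℝ} (ha : 0 ≤ a) (hb : 0 ≤ b) :
    -log (a / (a + b)) * a + -log (1 - a / (a + b)) * b =
      log 2 * (a + b) - (a * log (a / ((a + b) / 2)) + b * log (b / ((b + a) / 2))) := by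
  rcases ha.eq_or_lt with rfl | ha
  · rcases hb.eq_or_lt with rfl | hb
    · simp
    · have : b / (b / 2) = 2 := by field_simp
      simp [this]
      ring
  rcases hb.eq_or_lt with rfl | hb
  · have : a / (a / 2) = 2 := by field_simp
    simp [this, ha.ne']
    ring
  have hs : 0 < a + b := by positivity
  have e : 1 - a / (a + b) = b / (a + b) := by field_simp; ring
  have e1 : a / ((a + b) / 2) = 2 * (a / (a + b)) := by field_simp
  have e2 : b / ((b + a) / 2) = 2 * (b / (a + b)) := by field_simp; ring
  rw [e, e1, e2, log_mul two_ne_zero (div_pos ha hs).ne',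
    log_mul two_ne_zero (div_pos hb hs).ne']
  ring

lemma integrable_mul_log_div_half_add {ν : Measure 𝒳} {a b : 𝒳 → ℝ} (ha : Integrable a ν)
    (hb : Integrable b ν) (ham : Measurable a) (hbm : Measurable b)
    (ha0 : ∀ x, 0 ≤ a x) (hb0 : ∀ x, 0 ≤ b x) :
    Integrable (fun x => a x * log (a x / ((a x + b x) / 2))) ν :=
  (ha.add hb).mono' (by fun_prop : Measurable _).aestronglyMeasurable
    (ae_of_all _ fun x => abs_mul_log_div_half_add_le (ha0 x) (hb0 x))

/-- Divergence from the mixture, for measures given by densities. -/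
lemma klDiv_withDensity_mixture (ν : Measure 𝒳) [SigmaFinite ν] {a b : 𝒳 → ℝ}
    (ha : Measurable a) (hb : Measurable b) (ha0 : ∀ x, 0 ≤ a x) (hb0 : ∀ x, 0 ≤ b x) :
    klDiv (ν.withDensity fun x => ENNReal.ofReal (a x))
      ((2 : ℝ≥0∞)⁻¹ • ((ν.withDensity fun x => ENNReal.ofReal (a x)) +
        ν.withDensity fun x => ENNReal.ofReal (b x))) =
      ∫ x, a x * log (a x / ((a x + b x) / 2)) ∂ν := by
  have hM : (2 : ℝ≥0∞)⁻¹ • ((ν.withDensity fun x => ENNReal.ofReal (a x)) +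
        ν.withDensity fun x => ENNReal.ofReal (b x)) =
      ν.withDensity fun x => ENNReal.ofReal ((a x + b x) / 2) := by
    rw [← withDensity_add_left ha.ennreal_ofReal,
      ← withDensity_smul _ (ha.ennreal_ofReal.add hb.ennreal_ofReal)]
    congr 1
    ext x
    simp only [Pi.smul_apply, Pi.add_apply, smul_eq_mul]
    rw [div_eq_inv_mul, ENNReal.ofReal_mul (by norm_num), ENNReal.ofReal_add (ha0 x) (hb0 x),
      ENNReal.ofReal_inv_of_pos (by norm_num), ENNReal.ofReal_ofNat]
  have hm : Measurable fun x => (a x + b x) / 2 := (ha.add hb).div_const 2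
  have hg : Measurable fun x => a x / ((a x + b x) / 2) := ha.div hm
  have hP : (ν.withDensity fun x => ENNReal.ofReal (a x)) =
      (ν.withDensity fun x => ENNReal.ofReal ((a x + b x) / 2)).withDensity
        fun x => ENNReal.ofReal (a x / ((a x + b x) / 2)) := by
    rw [← withDensity_mul _ hm.ennreal_ofReal hg.ennreal_ofReal]
    congr 1
    ext x
    have hx : 0 ≤ (a x + b x) / 2 := by linarith [ha0 x, hb0 x]
    rw [Pi.mul_apply, ← ENNReal.ofReal_mul hx]
    rcases hx.eq_or_lt with h | h
    · have : a x = 0 := by linarith [ha0 x, hb0 x]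
      simp [this]
    · rw [mul_div_cancel₀ _ h.ne']
  have hae : ∀ᵐ x ∂(ν.withDensity fun x => ENNReal.ofReal (a x)),
      (ν.withDensity fun x => ENNReal.ofReal (a x)).rnDeriv
        (ν.withDensity fun x => ENNReal.ofReal ((a x + b x) / 2)) x =
        ENNReal.ofReal (a x / ((a x + b x) / 2)) := by
    rw [hP]
    exact (withDensity_absolutelyContinuous _ _).ae_le
      (Measure.rnDeriv_withDensity _ hg.ennreal_ofReal)
  rw [klDiv, hM, integral_congr_ae (hae.mono fun x hx => by
    show log _ = log (a x / ((a x + b x) / 2))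
    rw [hx, ENNReal.toReal_ofReal (div_nonneg (ha0 x) (by linarith [ha0 x, hb0 x]))])]
  rw [integral_withDensity_eq_integral_toReal_smul ha.ennreal_ofReal
    (ae_of_all _ fun _ => ENNReal.ofReal_lt_top)]
  simp_rw [ENNReal.toReal_ofReal (ha0 _), smul_eq_mul]

lemma lintegral_ofReal_eq_one_of_integral_eq_one {μ : Measure 𝒳} {f : 𝒳 → ℝ}
    (hf0 : ∀ x, 0 ≤ f x) (hf1 : ∫ x, f x ∂μ = 1) : ∫⁻ x, ENNReal.ofReal (f x) ∂μ = 1 := by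
  have hi : Integrable f μ := by
    by_contra h
    simp [integral_undef h] at hf1
  rw [← ofReal_integral_eq_lintegral_ofReal hi (ae_of_all _ hf0), hf1, ENNReal.ofReal_one]

lemma pwDensity_nonneg {ρ : Measure 𝒴} {p : 𝒳 × 𝒴 → ℝ} {w : 𝒴 → ℝ} (hp0 : ∀ z, 0 ≤ p z)
    (hw0 : ∀ y, 0 ≤ w y) (x : 𝒳) : 0 ≤ pwDensity ρ p w x :=
  integral_nonneg fun _ => mul_nonneg (hp0 _) (hw0 _)

lemma measurable_pwDensity (ρ : Measure 𝒴) [SigmaFinite ρ] {p : 𝒳 × 𝒴 → ℝ} {w : 𝒴 → ℝ}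
    (hp : Measurable p) (hw : Measurable w) : Measurable (pwDensity ρ p w) :=
  (StronglyMeasurable.integral_prod_right' (f := fun z : 𝒳 × 𝒴 => p z * w z.2)
    (by fun_prop : Measurable _).stronglyMeasurable).measurable

variable {ν : Measure 𝒳} {ρ : Measure 𝒴} [SigmaFinite ν] [SigmaFinite ρ]

lemma lintegral_lintegral_reweighted_eq_one {p : 𝒳 × 𝒴 → ℝ} (hp : Measurable p)
    (hp0 : ∀ z, 0 ≤ p z) (hp1 : ∫ z, p z ∂(ν.prod ρ) = 1)
    {w : 𝒴 → ℝ} (hw : Measurable w) (hw0 : ∀ y, 0 ≤ w y)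
    (hw1 : ∫ y, (∫ x, p (x, y) ∂ν) * w y ∂ρ = 1) :
    ∫⁻ x, ∫⁻ y, ENNReal.ofReal (p (x, y) * w y) ∂ρ ∂ν = 1 := by
  have hi : Integrable p (ν.prod ρ) := by
    by_contra h
    simp [integral_undef h] at hp1
  rw [lintegral_lintegral_swap (by fun_prop)]
  rw [← lintegral_ofReal_eq_one_of_integral_eq_one
    (fun y => mul_nonneg (integral_nonneg fun x => hp0 (x, y)) (hw0 y)) hw1]
  refine lintegral_congr_ae (hi.prod_left_ae.mono fun y hy => ?_)
  dsimp only
  rw [← integral_mul_const, ofReal_integral_eq_lintegral_ofReal (hy.mul_const _)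
    (ae_of_all _ fun x => mul_nonneg (hp0 _) (hw0 y))]

lemma ofReal_pwDensity_ae_eq {p : 𝒳 × 𝒴 → ℝ} (hp : Measurable p)
    (hp0 : ∀ z, 0 ≤ p z) (hp1 : ∫ z, p z ∂(ν.prod ρ) = 1)
    {w : 𝒴 → ℝ} (hw : Measurable w) (hw0 : ∀ y, 0 ≤ w y)
    (hw1 : ∫ y, (∫ x, p (x, y) ∂ν) * w y ∂ρ = 1) :
    ∀ᵐ x ∂ν, ENNReal.ofReal (pwDensity ρ p w x) =
      ∫⁻ y, ENNReal.ofReal (p (x, y) * w y) ∂ρ := by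
  have h1 := lintegral_lintegral_reweighted_eq_one hp hp0 hp1 hw hw0 hw1
  have hmeas : Measurable fun x => ∫⁻ y, ENNReal.ofReal (p (x, y) * w y) ∂ρ :=
    Measurable.lintegral_prod_right' (f := fun z : 𝒳 × 𝒴 => ENNReal.ofReal (p z * w z.2))
      (by fun_prop)
  filter_upwards [ae_lt_top hmeas (by simp [h1])] with x hx
  have hnn : 0 ≤ᵐ[ρ] fun y => p (x, y) * w y := ae_of_all _ fun y => mul_nonneg (hp0 _) (hw0 y)
  have hm : Measurable fun y => p (x, y) * w y := by fun_prop
  rw [pwDensity, ofReal_integral_eq_lintegral_ofReal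
    ((lintegral_ofReal_ne_top_iff_integrable hm.aestronglyMeasurable hnn).1 hx.ne) hnn]

lemma lintegral_ofReal_pwDensity {p : 𝒳 × 𝒴 → ℝ} (hp : Measurable p)
    (hp0 : ∀ z, 0 ≤ p z) (hp1 : ∫ z, p z ∂(ν.prod ρ) = 1)
    {w : 𝒴 → ℝ} (hw : Measurable w) (hw0 : ∀ y, 0 ≤ w y)
    (hw1 : ∫ y, (∫ x, p (x, y) ∂ν) * w y ∂ρ = 1) :
    ∫⁻ x, ENNReal.ofReal (pwDensity ρ p w x) ∂ν = 1 := by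
  rw [lintegral_congr_ae (ofReal_pwDensity_ae_eq hp hp0 hp1 hw hw0 hw1),
    lintegral_lintegral_reweighted_eq_one hp hp0 hp1 hw hw0 hw1]

lemma ganObjective_eq_lintegral_crossEntropy {p : 𝒳 × 𝒴 → ℝ} (hp : Measurable p)
    (hp0 : ∀ z, 0 ≤ p z) (hp1 : ∫ z, p z ∂(ν.prod ρ) = 1)
    {q : 𝒳 → ℝ} (hq : Measurable q) (hq0 : ∀ x, 0 ≤ q x) (hq1 : ∫ x, q x ∂ν = 1)
    {w : 𝒴 → ℝ} (hw : Measurable w) (hw0 : ∀ y, 0 ≤ w y)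
    (hw1 : ∫ y, (∫ x, p (x, y) ∂ν) * w y ∂ρ = 1)
    {d : 𝒳 → ℝ} (hd : Measurable d) (hd01 : ∀ x, d x ∈ Set.Icc (0 : ℝ) 1) :
    ganObjective ν ρ p q w d =
      ∫⁻ x, ENNReal.ofReal (-log (d x) * pwDensity ρ p w x + -log (1 - d x) * q x) ∂ν := by
  have hl0 (x) : 0 ≤ -log (d x) := neg_nonneg.2 (log_nonpos (hd01 x).1 (hd01 x).2)
  have hl1 (x) : 0 ≤ -log (1 - d x) :=
    neg_nonneg.2 (log_nonpos (by linarith [(hd01 x).2]) (by linarith [(hd01 x).1]))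
  have hpw : Measurable (pwDensity ρ p w) := measurable_pwDensity ρ hp hw
  have hpw0 := pwDensity_nonneg (ρ := ρ) hp0 hw0
  have hA : Measurable fun x => ∫⁻ y, ENNReal.ofReal (p (x, y) * w y) ∂ρ :=
    Measurable.lintegral_prod_right' (f := fun z : 𝒳 × 𝒴 => ENNReal.ofReal (p z * w z.2))
      (by fun_prop)
  have hS : Measurable fun x => ∫⁻ y, ENNReal.ofReal (p (x, y)) ∂ρ :=
    Measurable.lintegral_prod_right' (f := fun z : 𝒳 × 𝒴 => ENNReal.ofReal (p z)) (by fun_prop)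
  have hS1 : ∫⁻ x, ∫⁻ y, ENNReal.ofReal (p (x, y)) ∂ρ ∂ν = 1 := by
    rw [← lintegral_prod (fun z => ENNReal.ofReal (p z)) (by fun_prop)]
    exact lintegral_ofReal_eq_one_of_integral_eq_one hp0 hp1
  have hinner (x x' : 𝒳) :
      ∫⁻ y, ENNReal.ofReal ((-(w y * log (d x)) - log (1 - d x')) * (p (x, y) * q x')) ∂ρ =
        (ENNReal.ofReal (-log (d x)) * ∫⁻ y, ENNReal.ofReal (p (x, y) * w y) ∂ρ) *
            ENNReal.ofReal (q x') +
          (∫⁻ y, ENNReal.ofReal (p (x, y)) ∂ρ) * ENNReal.ofReal (-log (1 - d x') * q x') := by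
    have hsplit (y : 𝒴) :
        ENNReal.ofReal ((-(w y * log (d x)) - log (1 - d x')) * (p (x, y) * q x')) =
          ENNReal.ofReal (-log (d x)) * ENNReal.ofReal (p (x, y) * w y) * ENNReal.ofReal (q x') +
            ENNReal.ofReal (p (x, y)) * ENNReal.ofReal (-log (1 - d x') * q x') := by
      have h1 := mul_nonneg (hp0 (x, y)) (hw0 y)
      have h2 := mul_nonneg (hl1 x') (hq0 x')
      rw [← ENNReal.ofReal_mul (hl0 x), ← ENNReal.ofReal_mul (mul_nonneg (hl0 x) h1),
        ← ENNReal.ofReal_mul (hp0 _), ← ENNReal.ofReal_add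
          (mul_nonneg (mul_nonneg (hl0 x) h1) (hq0 x')) (mul_nonneg (hp0 _) h2)]
      congr 1
      ring
    simp_rw [hsplit]
    rw [lintegral_add_left (by fun_prop), lintegral_mul_const _ (by fun_prop),
      lintegral_const_mul _ (by fun_prop), lintegral_mul_const _ (by fun_prop)]
  rw [ganObjective, lintegral_prod _ (by fun_prop)]
  simp_rw [hinner]
  rw [lintegral_add_left (by fun_prop),
    lintegral_prod_mul
      (f := fun x => ENNReal.ofReal (-log (d x)) * ∫⁻ y, ENNReal.ofReal (p (x, y) * w y) ∂ρ)
      (g := fun x => ENNReal.ofReal (q x)) (by fun_prop) (by fun_prop),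
    lintegral_prod_mul
      (f := fun x => ∫⁻ y, ENNReal.ofReal (p (x, y)) ∂ρ)
      (g := fun x => ENNReal.ofReal (-log (1 - d x) * q x)) (by fun_prop) (by fun_prop),
    lintegral_ofReal_eq_one_of_integral_eq_one hq0 hq1, hS1, mul_one, one_mul,
    ← lintegral_add_left (by fun_prop)]
  refine lintegral_congr_ae ((ofReal_pwDensity_ae_eq hp hp0 hp1 hw hw0 hw1).mono fun x hx => ?_)
  dsimp only
  rw [← hx, ← ENNReal.ofReal_mul (hl0 x),
    ENNReal.ofReal_add (mul_nonneg (hl0 x) (hpw0 x)) (mul_nonneg (hl1 x) (hq0 x))]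

lemma lintegral_crossEntropy_eq_jsDiv {a b : 𝒳 → ℝ} (ham : Measurable a) (hbm : Measurable b)
    (ha0 : ∀ x, 0 ≤ a x) (hb0 : ∀ x, 0 ≤ b x) (ha1 : ∫ x, a x ∂ν = 1) (hb1 : ∫ x, b x ∂ν = 1) :
    ∫⁻ x, ENNReal.ofReal
        (-log (a x / (a x + b x)) * a x + -log (1 - a x / (a x + b x)) * b x) ∂ν =
      ENNReal.ofReal (log 4 - 2 *
        jsDiv (ν.withDensity fun x => ENNReal.ofReal (a x))
          (ν.withDensity fun x => ENNReal.ofReal (b x))) := by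
  have ha : Integrable a ν := by
    by_contra h
    simp [integral_undef h] at ha1
  have hb : Integrable b ν := by
    by_contra h
    simp [integral_undef h] at hb1
  have hab := integrable_mul_log_div_half_add ha hb ham hbm ha0 hb0
  have hba := integrable_mul_log_div_half_add hb ha hbm ham hb0 ha0
  have hab2 : Integrable (fun x => log 2 * (a x + b x)) ν := (ha.add hb).const_mul _
  have hsum : Integrable (fun x => a x * log (a x / ((a x + b x) / 2)) +
      b x * log (b x / ((b x + a x) / 2))) ν := hab.add hba
  have hnn (x) : 0 ≤ -log (a x / (a x + b x)) * a x + -log (1 - a x / (a x + b x)) * b x := by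
    have hd0 : 0 ≤ a x / (a x + b x) := div_nonneg (ha0 x) (add_nonneg (ha0 x) (hb0 x))
    have hd1 : a x / (a x + b x) ≤ 1 := div_le_one_of_le₀ (by linarith [hb0 x])
      (add_nonneg (ha0 x) (hb0 x))
    exact add_nonneg (mul_nonneg (neg_nonneg.2 (log_nonpos hd0 hd1)) (ha0 x))
      (mul_nonneg (neg_nonneg.2 (log_nonpos (by linarith) (by linarith))) (hb0 x))
  simp_rw [crossEntropy_div_add_eq (ha0 _) (hb0 _)] at hnn ⊢
  rw [← ofReal_integral_eq_lintegral_ofReal (by exact hab2.sub hsum) (ae_of_all _ hnn),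
    integral_sub hab2 hsum, integral_add hab hba, integral_const_mul,
    integral_add ha hb, ha1, hb1, jsDiv, klDiv_withDensity_mixture ν ham hbm ha0 hb0,
    add_comm (ν.withDensity fun x => ENNReal.ofReal (a x)),
    klDiv_withDensity_mixture ν hbm ham hb0 ha0]
  have h4 : log 4 = log 2 * 2 := by
    rw [show (4 : ℝ) = 2 * 2 by norm_num, log_mul two_ne_zero two_ne_zero]
    ring
  rw [h4]
  congr 1
  ring

end Auxiliary

/-- The weighted GAN loss is minimized at `d* = p^w/(p^w + q)`, with minimum value
`log 4 − 2·D_JS(P^w ‖ Q)`. -/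
theorem gan_objective_min
    {𝒳 𝒴 : Type*} [MeasurableSpace 𝒳] [MeasurableSpace 𝒴]
    (ν : Measure 𝒳) (ρ : Measure 𝒴) [SigmaFinite ν] [SigmaFinite ρ]
    (p : 𝒳 × 𝒴 → ℝ) (hp : Measurable p) (hp0 : ∀ z, 0 ≤ p z)
    (hp1 : ∫ z, p z ∂(ν.prod ρ) = 1)
    (q : 𝒳 → ℝ) (hq : Measurable q) (hq0 : ∀ x, 0 ≤ q x) (hq1 : ∫ x, q x ∂ν = 1)
    (w : 𝒴 → ℝ) (hw : Measurable w) (hw0 : ∀ y, 0 ≤ w y)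
    (hw1 : ∫ y, (∫ x, p (x, y) ∂ν) * w y ∂ρ = 1) :
    ganObjective ν ρ p q w
        (fun x => pwDensity ρ p w x / (pwDensity ρ p w x + q x)) =
      ENNReal.ofReal (Real.log 4 - 2 *
        jsDiv (ν.withDensity fun x => ENNReal.ofReal (pwDensity ρ p w x))
          (ν.withDensity fun x => ENNReal.ofReal (q x))) ∧
    ∀ d : 𝒳 → ℝ, Measurable d → (∀ x, d x ∈ Set.Ioo (0 : ℝ) 1) →
      ganObjective ν ρ p q w
          (fun x => pwDensity ρ p w x / (pwDensity ρ p w x + q x)) ≤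
        ganObjective ν ρ p q w d := by
  have hpw : Measurable (pwDensity ρ p w) := measurable_pwDensity ρ hp hw
  have hpw0 := pwDensity_nonneg (ρ := ρ) hp0 hw0
  have hpw1 : ∫ x, pwDensity ρ p w x ∂ν = 1 := by
    rw [integral_eq_lintegral_of_nonneg_ae (ae_of_all _ hpw0) hpw.aestronglyMeasurable,
      lintegral_ofReal_pwDensity hp hp0 hp1 hw hw0 hw1, ENNReal.toReal_one]
  have hopt := ganObjective_eq_lintegral_crossEntropy hp hp0 hp1 hq hq0 hq1 hw hw0 hw1
    (d := fun x => pwDensity ρ p w x / (pwDensity ρ p w x + q x)) (by fun_prop)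
    fun x => ⟨div_nonneg (hpw0 x) (add_nonneg (hpw0 x) (hq0 x)),
      div_le_one_of_le₀ (by linarith [hq0 x]) (add_nonneg (hpw0 x) (hq0 x))⟩
  rw [hopt]
  refine ⟨lintegral_crossEntropy_eq_jsDiv hpw hq hpw0 hq0 hpw1 hq1, fun d hd hd01 => ?_⟩
  rw [ganObjective_eq_lintegral_crossEntropy hp hp0 hp1 hq hq0 hq1 hw hw0 hw1 hd
    fun x => Set.Ioo_subset_Icc_self (hd01 x)]
  exact lintegral_mono fun x =>
    ENNReal.ofReal_le_ofReal (crossEntropy_div_add_le (hpw0 x) (hq0 x) (hd01 x))
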